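/- arXiv:1502.06839 — 3 statements merged into one kernel-verified Lean document; each statement's English description precedes it below -/
import Mathlib

section
/- Let c : [0,1]² → ℝ be continuous on [0,1]², twice continuously differentiable on (0,1)², with ∂²c/∂x∂y(x,y) > 0 for all (x,y) ∈ (0,1)². Then the minimum of ∫_{[0,1]²} c dγ over all copula measures γ equals ∫₀¹ c(x, 1−x) dx, and it is attained by the countermonotone copula measure, i.e., the pushforward of the Lebesgue measure on [0,1] under the map x ↦ (x, 1−x). -/
open MeasureTheory

/-- The uniform (Lebesgue) measure on `[0,1]`. -/
noncomputable def unif : Measure ℝ := volume.restrict (Set.Icc (0:ℝ) 1)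

/-- A copula measure: a Borel probability measure on `[0,1]²` (viewed inside `ℝ × ℝ`)
whose two marginals are the uniform measure on `[0,1]`. -/
def IsCopula (γ : Measure (ℝ × ℝ)) : Prop :=
  IsProbabilityMeasure γ ∧ γ.map Prod.fst = unif ∧ γ.map Prod.snd = unif

/-- The mixed second partial derivative `∂²c/∂x∂y` of `c : ℝ × ℝ → ℝ` at `p`. -/
noncomputable def mixedPartial (c : ℝ × ℝ → ℝ) (p : ℝ × ℝ) : ℝ :=
  deriv (fun x => deriv (fun y => c (x, y)) p.2) p.1

section

open Set

instance : IsProbabilityMeasure unif :=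
  ⟨by simp [unif]⟩

lemma unif_eq_restrict_Ioo : unif = volume.restrict (Ioo (0:ℝ) 1) :=
  (Measure.restrict_congr_set Ioo_ae_eq_Icc).symm

lemma ae_unif_mem_Ioo : ∀ᵐ x ∂unif, x ∈ Ioo (0:ℝ) 1 := by
  rw [unif_eq_restrict_Ioo]
  exact ae_restrict_mem measurableSet_Ioo

lemma measurePreserving_one_sub_unif : MeasurePreserving (fun x : ℝ => 1 - x) unif unif := by
  have h := (Measure.measurePreserving_sub_left (volume : Measure ℝ) 1).restrict_preimage
    (s := Icc (0:ℝ) 1) measurableSet_Icc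
  simpa [unif] using h

lemma integral_unif (f : ℝ → ℝ) : ∫ x, f x ∂unif = ∫ x in (0:ℝ)..1, f x := by
  rw [intervalIntegral.integral_of_le zero_le_one, unif, integral_Icc_eq_integral_Ioc]

lemma isCopula_countermonotone : IsCopula (unif.map fun x => (x, 1 - x)) := by
  have hm : Measurable fun x : ℝ => (x, 1 - x) := by fun_prop
  refine ⟨Measure.isProbabilityMeasure_map hm.aemeasurable, ?_, ?_⟩
  · rw [Measure.map_map measurable_fst hm]
    exact Measure.map_id
  · rw [Measure.map_map measurable_snd hm]
    exact measurePreserving_one_sub_unif.map_eq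

lemma IsCopula.measurePreserving_fst {γ : Measure (ℝ × ℝ)} (hγ : IsCopula γ) :
    MeasurePreserving Prod.fst γ unif := ⟨measurable_fst, hγ.2.1⟩

lemma IsCopula.measurePreserving_snd {γ : Measure (ℝ × ℝ)} (hγ : IsCopula γ) :
    MeasurePreserving Prod.snd γ unif := ⟨measurable_snd, hγ.2.2⟩

lemma IsCopula.ae_mem {γ : Measure (ℝ × ℝ)} (hγ : IsCopula γ) :
    ∀ᵐ p ∂γ, p ∈ Ioo (0:ℝ) 1 ×ˢ Ioo (0:ℝ) 1 := by
  filter_upwards [hγ.measurePreserving_fst.quasiMeasurePreserving.ae ae_unif_mem_Ioo,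
    hγ.measurePreserving_snd.quasiMeasurePreserving.ae ae_unif_mem_Ioo] with p h1 h2
  exact ⟨h1, h2⟩

lemma IsCopula.aestronglyMeasurable {γ : Measure (ℝ × ℝ)} (hγ : IsCopula γ) {c : ℝ × ℝ → ℝ}
    (hc : ContinuousOn c (Icc 0 1 ×ˢ Icc 0 1)) : AEStronglyMeasurable c γ := by
  have h := (hc.mono (prod_mono Ioo_subset_Icc_self Ioo_subset_Icc_self)).aestronglyMeasurable
    (μ := γ) (measurableSet_Ioo.prod measurableSet_Ioo)
  rwa [Measure.restrict_eq_self_of_ae_mem hγ.ae_mem] at h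

lemma exists_abs_le_of_continuousOn_square {c : ℝ × ℝ → ℝ}
    (hc : ContinuousOn c (Icc 0 1 ×ˢ Icc 0 1)) :
    ∃ C, ∀ p ∈ Ioo (0:ℝ) 1 ×ˢ Ioo (0:ℝ) 1, |c p| ≤ C := by
  obtain ⟨C, hC⟩ := (isCompact_Icc.prod isCompact_Icc).exists_bound_of_continuousOn hc
  exact ⟨C, fun p hp => hC p (prod_mono Ioo_subset_Icc_self Ioo_subset_Icc_self hp)⟩

lemma IsCopula.integrable {γ : Measure (ℝ × ℝ)} (hγ : IsCopula γ) {c : ℝ × ℝ → ℝ}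
    (hc : ContinuousOn c (Icc 0 1 ×ˢ Icc 0 1)) : Integrable c γ := by
  have := hγ.1
  obtain ⟨C, hC⟩ := exists_abs_le_of_continuousOn_square hc
  refine Integrable.of_bound (hγ.aestronglyMeasurable hc) C ?_
  filter_upwards [hγ.ae_mem] with p hp using hC p hp

lemma hasDerivAt_section_snd {c : ℝ × ℝ → ℝ} {x y : ℝ} (h : DifferentiableAt ℝ c (x, y)) :
    HasDerivAt (fun t => c (x, t)) (fderiv ℝ c (x, y) (0, 1)) y :=
  h.hasFDerivAt.comp_hasDerivAt y ((hasDerivAt_const y x).prodMk (hasDerivAt_id y))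

lemma one_sub_mem_Ioo {x : ℝ} (hx : x ∈ Ioo (0:ℝ) 1) : 1 - x ∈ Ioo (0:ℝ) 1 :=
  ⟨by linarith [hx.2], by linarith [hx.1]⟩

/-- A Kantorovich potential for the countermonotone coupling: an antiderivative of
`t ↦ ∂c/∂y (1 - t, t)`. -/
lemma exists_kantorovich_potential {c : ℝ × ℝ → ℝ}
    (hC2 : ContDiffOn ℝ 2 c (Ioo 0 1 ×ˢ Ioo 0 1))
    (hmix : ∀ p ∈ Ioo (0:ℝ) 1 ×ˢ Ioo (0:ℝ) 1, 0 < mixedPartial c p) :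
    ∃ ψ : ℝ → ℝ, ContinuousOn ψ (Ioo 0 1) ∧ ∀ x ∈ Ioo (0:ℝ) 1, ∀ y ∈ Ioo (0:ℝ) 1,
      c (x, 1 - x) - ψ (1 - x) + ψ y ≤ c (x, y) := by
  have hopen : IsOpen (Ioo (0:ℝ) 1 ×ˢ Ioo (0:ℝ) 1) := isOpen_Ioo.prod isOpen_Ioo
  have hdiff : ∀ p ∈ Ioo (0:ℝ) 1 ×ˢ Ioo (0:ℝ) 1, DifferentiableAt ℝ c p := fun p hp =>
    (hC2.differentiableOn (by norm_num)).differentiableAt (hopen.mem_nhds hp)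
  have hfd : ContinuousOn (fderiv ℝ c) (Ioo 0 1 ×ˢ Ioo 0 1) :=
    hC2.continuousOn_fderiv_of_isOpen hopen (by norm_num)
  set g : ℝ → ℝ := fun t => fderiv ℝ c (1 - t, t) (0, 1) with hg
  have hgc : ContinuousOn g (Ioo 0 1) := by
    have : ContinuousOn (fun t : ℝ => fderiv ℝ c (1 - t, t)) (Ioo 0 1) :=
      hfd.comp (by fun_prop) fun t ht => ⟨one_sub_mem_Ioo ht, ht⟩
    exact this.clm_apply continuousOn_const
  have hmono : ∀ y ∈ Ioo (0:ℝ) 1,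
      MonotoneOn (fun x => fderiv ℝ c (x, y) (0, 1)) (Ioo 0 1) := by
    intro y hy
    have h : StrictMonoOn (fun x => deriv (fun t => c (x, t)) y) (Ioo 0 1) := by
      refine strictMonoOn_of_deriv_pos (convex_Ioo 0 1) ?_ ?_
      · intro x hx
        exact (differentiableAt_of_deriv_ne_zero
          (hmix (x, y) ⟨hx, hy⟩).ne').continuousAt.continuousWithinAt
      · intro x hx
        rw [interior_Ioo] at hx
        exact hmix (x, y) ⟨hx, hy⟩
    exact h.monotoneOn.congr fun x hx => (hasDerivAt_section_snd (hdiff (x, y) ⟨hx, hy⟩)).deriv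
  have hψ : ∀ y ∈ Ioo (0:ℝ) 1, HasDerivAt (fun y => ∫ t in (1/2:ℝ)..y, g t) (g y) y := by
    intro y hy
    have hhalf : (1/2:ℝ) ∈ Ioo (0:ℝ) 1 := by norm_num
    refine intervalIntegral.integral_hasDerivAt_right ?_ ?_ ?_
    · exact (hgc.mono (ordConnected_Ioo.uIcc_subset hhalf hy)).intervalIntegrable
    · exact hgc.stronglyMeasurableAtFilter isOpen_Ioo y hy
    · exact hgc.continuousAt (isOpen_Ioo.mem_nhds hy)
  refine ⟨fun y => ∫ t in (1/2:ℝ)..y, g t,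
    fun y hy => (hψ y hy).continuousAt.continuousWithinAt, fun x hx y hy => ?_⟩
  set F : ℝ → ℝ := fun y => c (x, y) - ∫ t in (1/2:ℝ)..y, g t with hF
  have hFd : ∀ y ∈ Ioo (0:ℝ) 1, HasDerivAt F (fderiv ℝ c (x, y) (0, 1) - g y) y :=
    fun y hy => (hasDerivAt_section_snd (hdiff (x, y) ⟨hx, hy⟩)).sub (hψ y hy)
  have key : F (1 - x) ≤ F y := by
    have hx' := one_sub_mem_Ioo hx
    rcases le_total (1 - x) y with hxy | hxy
    · have hsub : Icc (1 - x) y ⊆ Ioo 0 1 := ordConnected_Ioo.out hx' hy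
      refine monotoneOn_of_deriv_nonneg (convex_Icc (1 - x) y)
        (fun z hz => (hFd z (hsub hz)).continuousAt.continuousWithinAt)
        (fun z hz => (hFd z (hsub (interior_subset hz))).differentiableAt.differentiableWithinAt)
        (fun z hz => ?_) (left_mem_Icc.2 hxy) (right_mem_Icc.2 hxy) hxy
      have hz := interior_subset hz
      rw [(hFd z (hsub hz)).deriv, sub_nonneg]
      exact hmono z (hsub hz) (one_sub_mem_Ioo (hsub hz)) hx (by linarith [hz.1])
    · have hsub : Icc y (1 - x) ⊆ Ioo 0 1 := ordConnected_Ioo.out hy hx'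
      refine antitoneOn_of_deriv_nonpos (convex_Icc y (1 - x))
        (fun z hz => (hFd z (hsub hz)).continuousAt.continuousWithinAt)
        (fun z hz => (hFd z (hsub (interior_subset hz))).differentiableAt.differentiableWithinAt)
        (fun z hz => ?_) (left_mem_Icc.2 hxy) (right_mem_Icc.2 hxy) hxy
      have hz := interior_subset hz
      rw [(hFd z (hsub hz)).deriv, sub_nonpos]
      exact hmono z (hsub hz) hx (one_sub_mem_Ioo (hsub hz)) (by linarith [hz.2])
  simp only [hF] at key
  linarith

lemma integrable_unif_of_kantorovich_potential {c : ℝ × ℝ → ℝ} {ψ : ℝ → ℝ}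
    (hc : ContinuousOn c (Icc 0 1 ×ˢ Icc 0 1)) (hψ : ContinuousOn ψ (Ioo 0 1))
    (hle : ∀ x ∈ Ioo (0:ℝ) 1, ∀ y ∈ Ioo (0:ℝ) 1,
      c (x, 1 - x) - ψ (1 - x) + ψ y ≤ c (x, y)) : Integrable ψ unif := by
  obtain ⟨C, hC⟩ := exists_abs_le_of_continuousOn_square hc
  have hhalf : (1/2:ℝ) ∈ Ioo (0:ℝ) 1 := by norm_num
  refine Integrable.of_bound (C := |ψ (1/2)| + 2 * C) ?_ ?_
  · rw [unif_eq_restrict_Ioo]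
    exact hψ.aestronglyMeasurable measurableSet_Ioo
  · filter_upwards [ae_unif_mem_Ioo] with y hy
    have hy' := one_sub_mem_Ioo hy
    have upper := hle (1/2) hhalf y hy
    have lower := hle (1 - y) hy' (1/2) hhalf
    rw [sub_sub_cancel] at lower
    rw [show (1 - 1/2 : ℝ) = 1/2 by norm_num] at upper
    have h1 := abs_le.1 (hC (1/2, 1/2) ⟨hhalf, hhalf⟩)
    have h2 := abs_le.1 (hC (1/2, y) ⟨hhalf, hy⟩)
    have h3 := abs_le.1 (hC (1 - y, y) ⟨hy', hy⟩)
    have h4 := abs_le.1 (hC (1 - y, 1/2) ⟨hy', hhalf⟩)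
    have h5 := le_abs_self (ψ (1/2))
    have h6 := neg_abs_le (ψ (1/2))
    rw [Real.norm_eq_abs, abs_le]
    constructor <;> linarith

/-- Weak Kantorovich duality against the countermonotone coupling. -/
lemma IsCopula.integral_unif_le {γ : Measure (ℝ × ℝ)} (hγ : IsCopula γ) {c : ℝ × ℝ → ℝ}
    {ψ : ℝ → ℝ} (hc : Integrable c γ) (hd : Integrable (fun x => c (x, 1 - x)) unif)
    (hψ : Integrable ψ unif)
    (hle : ∀ x ∈ Ioo (0:ℝ) 1, ∀ y ∈ Ioo (0:ℝ) 1,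
      c (x, 1 - x) - ψ (1 - x) + ψ y ≤ c (x, y)) :
    ∫ x, c (x, 1 - x) ∂unif ≤ ∫ p, c p ∂γ := by
  have hψ' : Integrable (fun x => ψ (1 - x)) unif :=
    measurePreserving_one_sub_unif.integrable_comp_of_integrable hψ
  have hφ : Integrable (fun x => c (x, 1 - x) - ψ (1 - x)) unif := hd.sub hψ'
  have hψe : ∫ x, ψ (1 - x) ∂unif = ∫ x, ψ x ∂unif :=
    measurePreserving_one_sub_unif.integral_comp' (f := MeasurableEquiv.subLeft 1) ψ
  have hfst : Integrable (fun p : ℝ × ℝ => c (p.1, 1 - p.1) - ψ (1 - p.1)) γ :=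
    hγ.measurePreserving_fst.integrable_comp_of_integrable hφ
  have hsnd : Integrable (fun p : ℝ × ℝ => ψ p.2) γ :=
    hγ.measurePreserving_snd.integrable_comp_of_integrable hψ
  have e1 : ∫ p, (c (p.1, 1 - p.1) - ψ (1 - p.1)) ∂γ
      = ∫ x, (c (x, 1 - x) - ψ (1 - x)) ∂unif := by
    rw [← hγ.2.1, integral_map measurable_fst.aemeasurable]
    rw [hγ.2.1]
    exact hφ.aestronglyMeasurable
  have e2 : ∫ p, ψ p.2 ∂γ = ∫ x, ψ x ∂unif := by
    rw [← hγ.2.2, integral_map measurable_snd.aemeasurable]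
    rw [hγ.2.2]
    exact hψ.aestronglyMeasurable
  calc ∫ x, c (x, 1 - x) ∂unif
      = ∫ p, ((c (p.1, 1 - p.1) - ψ (1 - p.1)) + ψ p.2) ∂γ := by
        rw [integral_add hfst hsnd, e1, e2, integral_sub hd hψ', hψe, sub_add_cancel]
    _ ≤ ∫ p, c p ∂γ := by
        refine integral_mono_ae (hfst.add hsnd) hc ?_
        filter_upwards [hγ.ae_mem] with p hp using hle p.1 hp.1 p.2 hp.2

end

/-- **Fialová–Strauch minimum theorem.** If `c : [0,1]² → ℝ` is continuous, twice
continuously differentiable on `(0,1)²` with `∂²c/∂x∂y > 0` there, then the minimum of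
`∫ c dγ` over all copula measures `γ` equals `∫₀¹ c (x,1-x) dx`, attained by the countermonotone
copula measure, i.e. the pushforward of the uniform measure on `[0,1]` under `x ↦ (x,1-x)`. -/
theorem stmt_7 (c : ℝ × ℝ → ℝ)
    (hc : ContinuousOn c (Set.Icc 0 1 ×ˢ Set.Icc 0 1))
    (hC2 : ContDiffOn ℝ 2 c (Set.Ioo 0 1 ×ˢ Set.Ioo 0 1))
    (hmix : ∀ p ∈ Set.Ioo (0:ℝ) 1 ×ˢ Set.Ioo (0:ℝ) 1, 0 < mixedPartial c p) :
    IsCopula (unif.map fun x => (x, 1 - x)) ∧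
    (∫ p, c p ∂(unif.map fun x => (x, 1 - x))) = ∫ x in (0:ℝ)..1, c (x, 1 - x) ∧
    ∀ γ : Measure (ℝ × ℝ), IsCopula γ → ∫ x in (0:ℝ)..1, c (x, 1 - x) ≤ ∫ p, c p ∂γ := by
  have hm : Measurable fun x : ℝ => (x, 1 - x) := by fun_prop
  have hcop := isCopula_countermonotone
  refine ⟨hcop, ?_, fun γ hγ => ?_⟩
  · rw [integral_map hm.aemeasurable (hcop.aestronglyMeasurable hc), integral_unif]
  · obtain ⟨ψ, hψ, hle⟩ := exists_kantorovich_potential hC2 hmix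
    rw [← integral_unif fun x => c (x, 1 - x)]
    exact hγ.integral_unif_le (hγ.integrable hc) ((hcop.integrable hc).comp_measurable hm)
      (integrable_unif_of_kantorovich_potential hc hψ hle) hle
end

section
/- Let k ∈ (0,2) and let φ : [0,2] → ℝ be twice continuously differentiable with φ''(x) < 0 for x ∈ [0,k) and φ''(x) > 0 for x ∈ (k,2]. Suppose β ∈ (0,1) satisfies φ(2β) − φ(β) = β φ'(β). Define Γ : [0,1] → [0,1] by Γ(x) = β − x for x ∈ [0,β) and Γ(x) = x for x ∈ [β,1]. Then the pushforward of the Lebesgue measure on [0,1] under the map x ↦ (x, Γ(x)) maximizes ∫_{[0,1]²} φ(x+y) dγ over all copula measures γ. -/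
open MeasureTheory

/-- The reflection `x ↦ β - x` on `[0,β)`, glued to the identity on `[β,1]`, preserves the uniform
measure. -/
lemma map_unif_reflect {β : ℝ} (hβ : β ∈ Set.Ioo (0:ℝ) 1) :
    unif.map (fun x => if x < β then β - x else x) = unif := by
  have hmeas : Measurable (fun x : ℝ => if x < β then β - x else x) :=
    Measurable.ite measurableSet_Iio (by fun_prop) measurable_id
  have hsplit : unif = volume.restrict (Set.Ico 0 β) + volume.restrict (Set.Icc β 1) := by
    rw [unif, ← Set.Ico_union_Icc_eq_Icc hβ.1.le hβ.2.le]
    refine Measure.restrict_union ?_ measurableSet_Icc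
    exact Set.disjoint_left.2 fun x hx hx' => not_le.2 hx.2 hx'.1
  have hleft : (volume.restrict (Set.Ico 0 β)).map (fun x => if x < β then β - x else x)
      = volume.restrict (Set.Ico 0 β) := by
    have hcongr : (fun x => if x < β then β - x else x)
        =ᵐ[volume.restrict (Set.Ico 0 β)] fun x => β - x := by
      filter_upwards [ae_restrict_mem measurableSet_Ico] with x hx
      simp [hx.2]
    have hpre : (fun x => β - x) ⁻¹' Set.Ioc 0 β = Set.Ico 0 β := by
      ext x
      simp only [Set.mem_preimage, Set.mem_Ioc, Set.mem_Ico]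
      constructor <;> rintro ⟨h, h'⟩ <;> constructor <;> linarith
    have hmp := (Measure.measurePreserving_sub_left (volume : Measure ℝ) β).restrict_preimage
      (measurableSet_Ioc (a := 0) (b := β))
    rw [hpre] at hmp
    rw [Measure.map_congr hcongr, hmp.map_eq]
    exact Measure.restrict_congr_set Ioo_ae_eq_Ioc.symm |>.trans
      (Measure.restrict_congr_set Ioo_ae_eq_Ico)
  have hright : (volume.restrict (Set.Icc β 1)).map (fun x => if x < β then β - x else x)
      = volume.restrict (Set.Icc β 1) := by
    have hcongr : (fun x => if x < β then β - x else x)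
        =ᵐ[volume.restrict (Set.Icc β 1)] id := by
      filter_upwards [ae_restrict_mem measurableSet_Icc] with x hx
      simp [not_lt.2 hx.1]
    rw [Measure.map_congr hcongr, Measure.map_id]
  rw [hsplit, Measure.map_add _ _ hmeas, hleft, hright]

lemma isProbabilityMeasure_unif : IsProbabilityMeasure unif :=
  ⟨by simp [unif]⟩

/-- The graph of a map preserving the uniform measure carries a copula measure. -/
lemma isCopula_map_graph {g : ℝ → ℝ} (hg : Measurable g) (hmap : unif.map g = unif) :
    IsCopula (unif.map fun x => (x, g x)) := by
  have := isProbabilityMeasure_unif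
  have hm : Measurable fun x : ℝ => (x, g x) := by fun_prop
  refine ⟨Measure.isProbabilityMeasure_map hm.aemeasurable, ?_, ?_⟩
  · rw [Measure.map_map measurable_fst hm]
    exact Measure.map_id
  · rw [Measure.map_map measurable_snd hm]
    exact hmap

namespace IsCopula

variable {γ : Measure (ℝ × ℝ)}

lemma ae_mem_s10 (hγ : IsCopula γ) : ∀ᵐ p ∂γ, p.1 ∈ Set.Icc (0:ℝ) 1 ∧ p.2 ∈ Set.Icc (0:ℝ) 1 := by
  have h : ∀ᵐ x ∂unif, x ∈ Set.Icc (0:ℝ) 1 := ae_restrict_mem measurableSet_Icc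
  have h₁ := h
  have h₂ := h
  rw [← hγ.2.1] at h₁
  rw [← hγ.2.2] at h₂
  filter_upwards [ae_of_ae_map measurable_fst.aemeasurable h₁,
    ae_of_ae_map measurable_snd.aemeasurable h₂] with p hp hp'
  exact ⟨hp, hp'⟩

lemma integrable_add (hγ : IsCopula γ) {f : ℝ → ℝ} (hf : Integrable f unif) :
    Integrable (fun p => f p.1 + f p.2) γ := by
  have h₁ : Integrable f (γ.map Prod.fst) := hγ.2.1.symm ▸ hf
  have h₂ : Integrable f (γ.map Prod.snd) := hγ.2.2.symm ▸ hf
  exact (h₁.comp_measurable measurable_fst).add (h₂.comp_measurable measurable_snd)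

lemma integral_add (hγ : IsCopula γ) {f : ℝ → ℝ} (hf : Integrable f unif) :
    ∫ p, (f p.1 + f p.2) ∂γ = 2 * ∫ x, f x ∂unif := by
  have h₁ : Integrable f (γ.map Prod.fst) := hγ.2.1.symm ▸ hf
  have h₂ : Integrable f (γ.map Prod.snd) := hγ.2.2.symm ▸ hf
  have hsum : ∫ p, (f p.1 + f p.2) ∂γ = ∫ p, f p.1 ∂γ + ∫ p, f p.2 ∂γ :=
    MeasureTheory.integral_add (h₁.comp_measurable measurable_fst)
      (h₂.comp_measurable measurable_snd)
  rw [hsum, ← integral_map measurable_fst.aemeasurable h₁.aestronglyMeasurable,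
    ← integral_map measurable_snd.aemeasurable h₂.aestronglyMeasurable, hγ.2.1, hγ.2.2, two_mul]

lemma integrable_comp_add (hγ : IsCopula γ) {φ : ℝ → ℝ} (hφ : ContinuousOn φ (Set.Icc 0 2)) :
    Integrable (fun p => φ (p.1 + p.2)) γ := by
  have := hγ.1
  obtain ⟨C, hC⟩ := isCompact_Icc.exists_bound_of_continuousOn hφ
  have hmem : ∀ᵐ p ∂γ, p.1 + p.2 ∈ Set.Icc (0:ℝ) 2 := by
    filter_upwards [hγ.ae_mem_s10] with p ⟨hp, hp'⟩
    exact ⟨by linarith [hp.1, hp'.1], by linarith [hp.2, hp'.2]⟩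
  have hcont : Continuous (Set.IccExtend zero_le_two ((Set.Icc (0:ℝ) 2).domRestrict φ)) :=
    hφ.domRestrict.Icc_extend'
  refine Integrable.of_bound
    (((hcont.comp (continuous_fst.add continuous_snd)).aestronglyMeasurable).congr ?_) C ?_
  · filter_upwards [hmem] with p hp
    exact Set.IccExtend_of_mem _ _ hp
  · filter_upwards [hmem] with p hp
    exact hC _ hp

/-- Weak duality: a copula measure concentrated on the contact set of a dual feasible potential is
optimal. -/
lemma integral_le_of_dual {γ₀ : Measure (ℝ × ℝ)} (hγ₀ : IsCopula γ₀) (hγ : IsCopula γ)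
    {φ f : ℝ → ℝ} (hφ : ContinuousOn φ (Set.Icc 0 2)) (hf : Integrable f unif)
    (hle : ∀ x ∈ Set.Icc (0:ℝ) 1, ∀ y ∈ Set.Icc (0:ℝ) 1, φ (x + y) ≤ f x + f y)
    (heq : ∀ᵐ p ∂γ₀, φ (p.1 + p.2) = f p.1 + f p.2) :
    ∫ p, φ (p.1 + p.2) ∂γ ≤ ∫ p, φ (p.1 + p.2) ∂γ₀ := by
  rw [integral_congr_ae heq, hγ₀.integral_add hf, ← hγ.integral_add hf]
  refine integral_mono_ae (hγ.integrable_comp_add hφ) (hγ.integrable_add hf) ?_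
  filter_upwards [hγ.ae_mem_s10] with p ⟨hp, hp'⟩
  exact hle _ hp _ hp'

end IsCopula

lemma iteratedDerivWithin_two_eq_deriv {φ : ℝ → ℝ} {a b x : ℝ}
    (hφ : ContDiffOn ℝ 2 φ (Set.Icc a b)) (hx : x ∈ Set.Ioo a b) :
    deriv^[2] φ x = iteratedDerivWithin 2 φ (Set.Icc a b) x := by
  rw [iteratedDerivWithin_eq_iteratedDeriv (uniqueDiffOn_Icc (hx.1.trans hx.2))
    (hφ.contDiffAt (Icc_mem_nhds hx.1 hx.2)) (Set.Ioo_subset_Icc_self hx), iteratedDeriv_eq_iterate]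

/-- Sign pattern of a concave-convex function with a double zero at `β` that vanishes again at
`2 * β`: the inflection point lies between the zeros, and the function changes sign at `2 * β`. -/
lemma sign_of_concave_convex {ψ : ℝ → ℝ} {k β : ℝ} (hβ : β ∈ Set.Ioo (0:ℝ) 1)
    (hconc : StrictConcaveOn ℝ (Set.Icc 0 k) ψ) (hconv : StrictConvexOn ℝ (Set.Icc k 2) ψ)
    (hψ : HasDerivAt ψ 0 β) (hψβ : ψ β = 0) (hψ2β : ψ (2 * β) = 0) :
    k < 2 * β ∧ (∀ x ∈ Set.Icc 0 (2 * β), ψ x ≤ 0) ∧ MonotoneOn ψ (Set.Icc (2 * β) 2) := by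
  obtain ⟨hβ0, hβ1⟩ := hβ
  have hβk : β < k := by
    by_contra! h
    have := hconv.lt_slope_of_hasDerivAt (x := β) (y := 2 * β) ⟨h, by linarith⟩
      ⟨by linarith, by linarith⟩ (by linarith) hψ
    simp [slope_def_field, hψβ, hψ2β] at this
  have hk2β : k < 2 * β := by
    by_contra! h
    have := hconc.slope_lt_of_hasDerivAt (x := β) (y := 2 * β) ⟨by linarith, by linarith⟩
      ⟨by linarith, by linarith⟩ (by linarith) hψ
    simp [slope_def_field, hψβ, hψ2β] at this
  have hleft : ∀ x ∈ Set.Icc 0 k, ψ x ≤ 0 := by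
    intro x hx
    rcases lt_trichotomy x β with h | rfl | h
    · have := hconc.concaveOn.le_slope_of_hasDerivAt hx ⟨hβ0.le, hβk.le⟩ h hψ
      rw [slope_def_field, hψβ, le_div_iff₀ (by linarith)] at this
      linarith
    · exact hψβ.le
    · have := hconc.concaveOn.slope_le_of_hasDerivAt ⟨hβ0.le, hβk.le⟩ hx h hψ
      rw [slope_def_field, hψβ, div_le_iff₀ (by linarith)] at this
      linarith
  have hψk : ψ k ≤ 0 := hleft k ⟨by linarith, le_rfl⟩
  refine ⟨hk2β, fun x hx => ?_, fun x hx y hy hxy => ?_⟩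
  · rcases le_total x k with h | h
    · exact hleft x ⟨hx.1, h⟩
    · have := hconv.convexOn.le_max_of_mem_Icc (x := k) (y := 2 * β) ⟨le_rfl, by linarith⟩
        ⟨hk2β.le, by linarith⟩ ⟨h, hx.2⟩
      rwa [hψ2β, max_eq_right hψk] at this
  · have hx0 : 0 ≤ ψ x := by
      rcases hx.1.eq_or_lt with h | h
      · rw [← h, hψ2β]
      · have := hconv.convexOn.slope_mono_adjacent (x := k) (y := 2 * β) (z := x)
          ⟨le_rfl, by linarith⟩ ⟨by linarith, hx.2⟩ hk2β h
        rw [hψ2β] at this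
        have h0 : 0 ≤ (0 - ψ k) / (2 * β - k) := div_nonneg (by linarith) (by linarith)
        have := h0.trans this
        rw [le_div_iff₀ (by linarith)] at this
        linarith
    rcases hxy.eq_or_lt with rfl | hxy
    · exact le_rfl
    · have := hconv.convexOn.slope_mono_adjacent (x := k) (y := x) (z := y)
        ⟨le_rfl, by linarith⟩ ⟨by linarith [hx.1], hy.2⟩ (by linarith [hx.1]) hxy
      have h0 : 0 ≤ (ψ x - ψ k) / (x - k) := div_nonneg (by linarith) (by linarith [hx.1])
      have := h0.trans this
      rw [le_div_iff₀ (by linarith)] at this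
      linarith

/-- Midpoint convexity of the positive part of a function that is nonpositive before `c` and
convex and eventually increasing afterwards. -/
lemma posPart_midpoint_le {ψ : ℝ → ℝ} {k c d : ℝ} (hkc : k < c) (hk : 0 ≤ k)
    (hconv : ConvexOn ℝ (Set.Icc k d) ψ) (hneg : ∀ x ∈ Set.Icc 0 c, ψ x ≤ 0)
    (hmono : MonotoneOn ψ (Set.Icc c d)) {x y : ℝ} (hx : x ∈ Set.Icc 0 d) (hy : y ∈ Set.Icc 0 d) :
    ψ ((x + y) / 2) ≤ (max (ψ x) 0 + max (ψ y) 0) / 2 := by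
  wlog hxy : x ≤ y generalizing x y
  · have := this hy hx (le_of_not_ge hxy)
    rwa [add_comm y, add_comm (max (ψ y) 0)] at this
  have hx0 := le_max_right (ψ x) 0
  have hy0 := le_max_right (ψ y) 0
  rcases le_total ((x + y) / 2) c with h | h
  · linarith [hneg _ ⟨by linarith [hx.1, hy.1], h⟩]
  have hmax : ψ (max x k) ≤ max (ψ x) 0 := by
    rcases le_total x k with h' | h'
    · rw [max_eq_right h']
      exact (hneg k ⟨hk, hkc.le⟩).trans hx0
    · rw [max_eq_left h']
      exact le_max_left _ _
  have hxk := le_max_left x k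
  have hky : k ≤ y := by linarith
  have hxky : max x k ≤ y := max_le hxy hky
  have hstep : ψ ((x + y) / 2) ≤ ψ ((max x k + y) / 2) :=
    hmono ⟨h, by linarith [hy.2]⟩ ⟨by linarith, by linarith [hy.2]⟩ (by linarith)
  have hmid := hconv.2 (show max x k ∈ Set.Icc k d from ⟨le_max_right _ _, hxky.trans hy.2⟩)
    (show y ∈ Set.Icc k d from ⟨hky, hy.2⟩)
    (show (0:ℝ) ≤ 1 / 2 by norm_num) (show (0:ℝ) ≤ 1 / 2 by norm_num) (by norm_num)
  simp only [smul_eq_mul] at hmid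
  rw [show 1 / 2 * max x k + 1 / 2 * y = (max x k + y) / 2 by ring] at hmid
  linarith [le_max_left (ψ y) 0]

/-- **Uckelmann-type theorem.** Let `k ∈ (0,2)` and `φ : [0,2] → ℝ` be twice continuously
differentiable with `φ'' < 0` on `[0,k)` and `φ'' > 0` on `(k,2]`. If `β ∈ (0,1)` solves
`φ(2β) − φ(β) = β φ'(β)`, and `Γ(x) = β − x` on `[0,β)`, `Γ(x) = x` on `[β,1]`, then the
pushforward of the uniform measure on `[0,1]` under `x ↦ (x, Γ x)` maximizes
`∫ φ(x+y) dγ` over all copula measures `γ`. -/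
theorem stmt_10 (k : ℝ) (hk : k ∈ Set.Ioo (0:ℝ) 2) (φ : ℝ → ℝ)
    (hφ : ContDiffOn ℝ 2 φ (Set.Icc 0 2))
    (hconc : ∀ x ∈ Set.Ico (0:ℝ) k, iteratedDerivWithin 2 φ (Set.Icc 0 2) x < 0)
    (hconv : ∀ x ∈ Set.Ioc k 2, 0 < iteratedDerivWithin 2 φ (Set.Icc 0 2) x)
    (β : ℝ) (hβ : β ∈ Set.Ioo (0:ℝ) 1)
    (hβeq : φ (2 * β) - φ β = β * derivWithin φ (Set.Icc 0 2) β) :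
    IsCopula (unif.map fun x => (x, if x < β then β - x else x)) ∧
    ∀ γ : Measure (ℝ × ℝ), IsCopula γ →
      ∫ p, φ (p.1 + p.2) ∂γ
        ≤ ∫ p, φ (p.1 + p.2) ∂(unif.map fun x => (x, if x < β then β - x else x)) := by
  have hβmem : β ∈ Set.Ioo (0:ℝ) 2 := ⟨hβ.1, by linarith [hβ.2]⟩
  set m := derivWithin φ (Set.Icc 0 2) β
  have hmeas : Measurable (fun x : ℝ => if x < β then β - x else x) :=
    Measurable.ite measurableSet_Iio (by fun_prop) measurable_id
  have hcop := isCopula_map_graph hmeas (map_unif_reflect hβ)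
  refine ⟨hcop, fun γ hγ => ?_⟩
  have hφc : ContinuousOn φ (Set.Icc 0 2) := hφ.continuousOn
  have hφ' : HasDerivAt φ m β :=
    ((hφ.differentiableOn (by norm_num)) β (Set.Ioo_subset_Icc_self hβmem)
      ).hasDerivWithinAt.hasDerivAt
      (Icc_mem_nhds hβmem.1 hβmem.2)
  have hφconc : StrictConcaveOn ℝ (Set.Icc 0 k) φ := by
    refine strictConcaveOn_of_deriv2_neg (convex_Icc _ _)
      (hφc.mono (Set.Icc_subset_Icc_right hk.2.le)) fun x hx => ?_
    rw [interior_Icc] at hx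
    rw [iteratedDerivWithin_two_eq_deriv hφ ⟨hx.1, hx.2.trans hk.2⟩]
    exact hconc x ⟨hx.1.le, hx.2⟩
  have hφconv : StrictConvexOn ℝ (Set.Icc k 2) φ := by
    refine strictConvexOn_of_deriv2_pos (convex_Icc _ _)
      (hφc.mono (Set.Icc_subset_Icc_left hk.1.le)) fun x hx => ?_
    rw [interior_Icc] at hx
    rw [iteratedDerivWithin_two_eq_deriv hφ ⟨hk.1.trans hx.1, hx.2⟩]
    exact hconv x ⟨hx.1, hx.2.le⟩
  set ℓ : ℝ → ℝ := fun t => φ β + m * (t - β) with hℓ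
  set ψ : ℝ → ℝ := fun t => φ t - ℓ t with hψ
  have hℓaff : ∀ x y a b : ℝ, a + b = 1 → ℓ (a * x + b * y) = a * ℓ x + b * ℓ y := by
    intro x y a b hab
    simp only [hℓ]
    linear_combination (m * β - φ β) * hab
  have hψconc : StrictConcaveOn ℝ (Set.Icc 0 k) ψ := by
    refine ⟨hφconc.1, fun x hx y hy hxy a b ha hb hab => ?_⟩
    have := hφconc.2 hx hy hxy ha hb hab
    simp only [hψ, smul_eq_mul, hℓaff x y a b hab] at this ⊢
    linarith
  have hψconv : StrictConvexOn ℝ (Set.Icc k 2) ψ := by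
    refine ⟨hφconv.1, fun x hx y hy hxy a b ha hb hab => ?_⟩
    have := hφconv.2 hx hy hxy ha hb hab
    simp only [hψ, smul_eq_mul, hℓaff x y a b hab] at this ⊢
    linarith
  have hψ' : HasDerivAt ψ 0 β := by
    have := hφ'.sub ((((hasDerivAt_id β).sub_const β).const_mul m).const_add (φ β))
    rw [mul_one, sub_self] at this
    exact this
  obtain ⟨hk2β, hneg, hmono⟩ := sign_of_concave_convex hβ hψconc hψconv hψ'
    (by simp [hψ, hℓ]) (by simp only [hψ, hℓ]; linear_combination hβeq)
  have hpos : ∀ x ∈ Set.Icc (2 * β) 2, 0 ≤ ψ x := by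
    intro x hx
    have := hmono ⟨le_rfl, hx.1.trans hx.2⟩ hx hx.1
    have h0 : ψ (2 * β) = 0 := by simp only [hψ, hℓ]; linear_combination hβeq
    linarith
  set f : ℝ → ℝ := fun x => (ℓ (2 * x) + max (ψ (2 * x)) 0) / 2 with hf
  have hfc : ContinuousOn f (Set.Icc 0 1) := by
    have hℓc : Continuous ℓ := by fun_prop
    have hmaps : Set.MapsTo (fun x : ℝ => 2 * x) (Set.Icc 0 1) (Set.Icc 0 2) :=
      fun x hx => ⟨by linarith [hx.1], by linarith [hx.2]⟩
    have hψc : ContinuousOn (fun x => ψ (2 * x)) (Set.Icc 0 1) :=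
      (hφc.sub hℓc.continuousOn).comp (by fun_prop) hmaps
    exact ((hℓc.comp (continuous_const.mul continuous_id)).continuousOn.add
      (ContinuousOn.sup hψc continuousOn_const)).div_const 2
  refine hcop.integral_le_of_dual hγ hφc (f := f) (hfc.integrableOn_compact isCompact_Icc) ?_ ?_
  · intro x hx y hy
    have := posPart_midpoint_le hk2β hk.1.le hψconv.convexOn hneg hmono
      (x := 2 * x) (y := 2 * y) ⟨by linarith [hx.1], by linarith [hx.2]⟩
      ⟨by linarith [hy.1], by linarith [hy.2]⟩
    rw [show (2 * x + 2 * y) / 2 = x + y by ring] at this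
    have hmid : ℓ (x + y) = (ℓ (2 * x) + ℓ (2 * y)) / 2 := by simp only [hℓ]; ring
    have hψxy : φ (x + y) = ψ (x + y) + ℓ (x + y) := by simp [hψ]
    simp only [hf]
    linarith
  · have hgraph : ∀ᵐ p ∂(unif.map fun x => (x, if x < β then β - x else x)),
        p.2 = if p.1 < β then β - p.1 else p.1 :=
      (ae_map_iff (measurable_id.prodMk hmeas).aemeasurable
        (measurableSet_eq_fun measurable_snd (hmeas.comp measurable_fst))).2
        (Filter.Eventually.of_forall fun _ => rfl)
    filter_upwards [hgraph, hcop.ae_mem_s10] with p hp ⟨hp₁, hp₂⟩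
    simp only [hf]
    split_ifs at hp with h
    · rw [max_eq_right (hneg (2 * p.1) ⟨by linarith [hp₁.1], by linarith⟩),
        max_eq_right (hneg (2 * p.2) ⟨by linarith [hp₂.1], by linarith [hp₁.1]⟩), hp,
        add_sub_cancel]
      simp only [hℓ]
      ring
    · rw [hp, max_eq_left (hpos (2 * p.1) ⟨by linarith, by linarith [hp₁.2]⟩), ← two_mul]
      simp only [hψ]
      ring
end

section
/- Let c : [0,1]² → ℝ be continuous, let c̲_n be the piecewise constant lower approximations of c on the dyadic squares I^n_{i,j} = [(i−1)/2ⁿ, i/2ⁿ) × [(j−1)/2ⁿ, j/2ⁿ) (c̲_n equal on I^n_{i,j} to the minimum of c on its closure), and for each n let γ̲ⁿ be a copula measure maximizing ∫ c̲_n dγ over all copula measures. Then the sequence (γ̲ⁿ) has a weakly convergent subsequence, and any weak limit point γ* of (γ̲ⁿ) is a copula measure that maximizes ∫_{[0,1]²} c dγ over all copula measures γ. -/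
open MeasureTheory Filter Topology

/-- Weak convergence of a sequence of measures: integrals of every bounded continuous
function converge. -/
def WeakTendsto {Z : Type*} [TopologicalSpace Z] [MeasurableSpace Z]
    (σ : ℕ → Measure Z) (ρ : Measure Z) : Prop :=
  ∀ g : BoundedContinuousFunction Z ℝ,
    Tendsto (fun n => ∫ z, g z ∂(σ n)) atTop (𝓝 (∫ z, g z ∂ρ))

/-- The closed dyadic square of generation `n` containing the point `p` (the closure of
the half-open dyadic square `I^n_{i,j}` containing `p`). -/
def dyadicSquare (n : ℕ) (p : ℝ × ℝ) : Set (ℝ × ℝ) :=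
  Set.Icc ((⌊p.1 * 2 ^ n⌋ : ℝ) / 2 ^ n) (((⌊p.1 * 2 ^ n⌋ : ℝ) + 1) / 2 ^ n) ×ˢ
    Set.Icc ((⌊p.2 * 2 ^ n⌋ : ℝ) / 2 ^ n) (((⌊p.2 * 2 ^ n⌋ : ℝ) + 1) / 2 ^ n)

/-- The lower piecewise constant approximation `c̲_n` of `c`: on each dyadic square
`I^n_{i,j}` it equals the minimum of `c` on the closure of that square. -/
noncomputable def lowerApprox (c : ℝ × ℝ → ℝ) (n : ℕ) (p : ℝ × ℝ) : ℝ :=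
  sInf (c '' dyadicSquare n p)

lemma Ico_prod_subset_Icc_prod :
    (Set.Ico (0:ℝ) 1 ×ˢ Set.Ico (0:ℝ) 1) ⊆ Set.Icc (0:ℝ) 1 ×ˢ Set.Icc (0:ℝ) 1 :=
  Set.prod_mono Set.Ico_subset_Icc_self Set.Ico_subset_Icc_self

lemma unif_ae_mem_Ico : ∀ᵐ x ∂unif, x ∈ Set.Ico (0:ℝ) 1 := by
  rw [unif, ← restrict_Ico_eq_restrict_Icc]
  exact ae_restrict_mem measurableSet_Ico

lemma IsCopula.ae_mem_Ico {γ : Measure (ℝ × ℝ)} (hγ : IsCopula γ) :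
    ∀ᵐ p ∂γ, p ∈ Set.Ico (0:ℝ) 1 ×ˢ Set.Ico (0:ℝ) 1 := by
  have h₁ := unif_ae_mem_Ico
  have h₂ := unif_ae_mem_Ico
  rw [← hγ.2.1] at h₁
  rw [← hγ.2.2] at h₂
  filter_upwards [ae_of_ae_map measurable_fst.aemeasurable h₁,
    ae_of_ae_map measurable_snd.aemeasurable h₂] with p hp₁ hp₂ using ⟨hp₁, hp₂⟩

/-- Every sequence of copula measures has a weakly convergent subsequence. -/
lemma exists_weakTendsto_subseq {σ : ℕ → Measure (ℝ × ℝ)} (hσ : ∀ n, IsCopula (σ n)) :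
    ∃ nk : ℕ → ℕ, StrictMono nk ∧ ∃ ρ : Measure (ℝ × ℝ),
      IsProbabilityMeasure ρ ∧ WeakTendsto (fun j => σ (nk j)) ρ := by
  let P : ℕ → ProbabilityMeasure (ℝ × ℝ) := fun n => ⟨σ n, (hσ n).1⟩
  have htight : IsTightMeasureSet
      {((μ : ProbabilityMeasure (ℝ × ℝ)) : Measure (ℝ × ℝ)) | μ ∈ Set.range P} := by
    rw [isTightMeasureSet_iff_exists_isCompact_measure_compl_le]
    refine fun ε _ => ⟨Set.Icc 0 1 ×ˢ Set.Icc 0 1, isCompact_Icc.prod isCompact_Icc, ?_⟩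
    rintro _ ⟨_, ⟨n, rfl⟩, rfl⟩
    have hnull : σ n (Set.Icc (0:ℝ) 1 ×ˢ Set.Icc (0:ℝ) 1)ᶜ = 0 :=
      mem_ae_iff.mp ((hσ n).ae_mem_Ico.mono fun p hp => Ico_prod_subset_Icc_prod hp)
    exact hnull.le.trans zero_le
  obtain ⟨ρ, -, nk, hnk, hlim⟩ := (isCompact_closure_of_isTightMeasureSet htight).isSeqCompact
    fun n => subset_closure (Set.mem_range_self n)
  exact ⟨nk, hnk, ρ, ρ.2, ProbabilityMeasure.tendsto_iff_forall_integral_tendsto.mp hlim⟩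

/-- A marginal shared by all terms of a weakly convergent sequence is a marginal of its limit. -/
lemma map_eq_of_weakTendsto {Y Z : Type*} [TopologicalSpace Y] [MeasurableSpace Y] [BorelSpace Y]
    [HasOuterApproxClosed Y] [TopologicalSpace Z] [MeasurableSpace Z] [OpensMeasurableSpace Z]
    {σ : ℕ → Measure Z} {ρ : Measure Z} [IsFiniteMeasure ρ] (hlim : WeakTendsto σ ρ)
    {f : Z → Y} (hf : Continuous f) {ν : Measure Y} [IsFiniteMeasure ν]
    (hσ : ∀ n, (σ n).map f = ν) : ρ.map f = ν := by
  refine ext_of_forall_integral_eq_of_IsFiniteMeasure fun g => ?_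
  have hmap : ∀ μ : Measure Z, ∫ y, g y ∂(μ.map f) = ∫ z, g (f z) ∂μ := fun μ =>
    integral_map hf.measurable.aemeasurable g.continuous.measurable.aestronglyMeasurable
  rw [hmap]
  refine tendsto_nhds_unique (hlim (g.compContinuous ⟨f, hf⟩)) ?_
  refine tendsto_const_nhds.congr fun n => ?_
  rw [← hσ n, hmap]
  rfl

lemma isCopula_of_weakTendsto {σ : ℕ → Measure (ℝ × ℝ)} {ρ : Measure (ℝ × ℝ)}
    [IsProbabilityMeasure ρ] (hσ : ∀ n, IsCopula (σ n)) (hlim : WeakTendsto σ ρ) :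
    IsCopula ρ := by
  have : IsFiniteMeasure unif := by unfold unif; infer_instance
  exact ⟨inferInstance, map_eq_of_weakTendsto hlim continuous_fst fun n => (hσ n).2.1,
    map_eq_of_weakTendsto hlim continuous_snd fun n => (hσ n).2.2⟩

lemma exists_boundedContinuous_eqOn {c : ℝ × ℝ → ℝ}
    (hc : ContinuousOn c (Set.Icc 0 1 ×ˢ Set.Icc 0 1)) :
    ∃ g : BoundedContinuousFunction (ℝ × ℝ) ℝ, Set.EqOn g c (Set.Icc 0 1 ×ˢ Set.Icc 0 1) := by
  have hK : IsCompact (Set.Icc (0:ℝ) 1 ×ˢ Set.Icc (0:ℝ) 1) := isCompact_Icc.prod isCompact_Icc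
  have := isCompact_iff_compactSpace.mp hK
  obtain ⟨g, -, hg⟩ := BoundedContinuousFunction.exists_norm_eq_domRestrict_eq_of_closed
    (BoundedContinuousFunction.mkOfCompact ⟨_, hc.domRestrict⟩) hK.isClosed
  exact ⟨g, fun p hp => DFunLike.congr_fun hg ⟨p, hp⟩⟩

lemma lowerApprox_apply (c : ℝ × ℝ → ℝ) (n : ℕ) (p : ℝ × ℝ) :
    lowerApprox c n p = sInf (c ''
      (Set.Icc ((⌊p.1 * 2 ^ n⌋ : ℝ) / 2 ^ n) (((⌊p.1 * 2 ^ n⌋ : ℝ) + 1) / 2 ^ n) ×ˢ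
        Set.Icc ((⌊p.2 * 2 ^ n⌋ : ℝ) / 2 ^ n) (((⌊p.2 * 2 ^ n⌋ : ℝ) + 1) / 2 ^ n))) := by
  delta lowerApprox dyadicSquare
  with_reducible rfl

/-- `lowerApprox c n` factors through the integer coordinates of the dyadic square. -/
lemma measurable_lowerApprox (c : ℝ × ℝ → ℝ) (n : ℕ) : Measurable (lowerApprox c n) := by
  have hfloor : Measurable fun p : ℝ × ℝ => (⌊p.1 * 2 ^ n⌋, ⌊p.2 * 2 ^ n⌋) := by fun_prop
  have hcorner : Measurable fun k : ℤ × ℤ => sInf (c ''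
      (Set.Icc ((k.1 : ℝ) / 2 ^ n) (((k.1 : ℝ) + 1) / 2 ^ n) ×ˢ
        Set.Icc ((k.2 : ℝ) / 2 ^ n) (((k.2 : ℝ) + 1) / 2 ^ n))) :=
    measurable_of_countable _
  have hcomp := hcorner.comp hfloor
  simp only [Function.comp_def, ← lowerApprox_apply] at hcomp
  exact hcomp

lemma mem_Icc_floor_div (n : ℕ) (x : ℝ) :
    x ∈ Set.Icc ((⌊x * 2 ^ n⌋ : ℝ) / 2 ^ n) (((⌊x * 2 ^ n⌋ : ℝ) + 1) / 2 ^ n) := by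
  constructor
  · rw [div_le_iff₀ (by positivity)]
    exact Int.floor_le _
  · rw [le_div_iff₀ (by positivity)]
    exact (Int.lt_floor_add_one _).le

lemma Icc_floor_div_subset (n : ℕ) {x : ℝ} (hx : x ∈ Set.Ico (0:ℝ) 1) :
    Set.Icc ((⌊x * 2 ^ n⌋ : ℝ) / 2 ^ n) (((⌊x * 2 ^ n⌋ : ℝ) + 1) / 2 ^ n) ⊆ Set.Icc 0 1 := by
  refine Set.Icc_subset_Icc (div_nonneg ?_ (by positivity)) ?_
  · have : 0 ≤ ⌊x * 2 ^ n⌋ := Int.floor_nonneg.mpr (mul_nonneg hx.1 (by positivity))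
    exact_mod_cast this
  · rw [div_le_one (by positivity)]
    have : ⌊x * 2 ^ n⌋ < 2 ^ n := by
      rw [Int.floor_lt]
      push_cast
      exact mul_lt_of_lt_one_left (by positivity) hx.2
    exact_mod_cast Int.add_one_le_of_lt this

lemma abs_sub_le_of_mem_Icc_floor_div {n : ℕ} {x y : ℝ}
    (hy : y ∈ Set.Icc ((⌊x * 2 ^ n⌋ : ℝ) / 2 ^ n) (((⌊x * 2 ^ n⌋ : ℝ) + 1) / 2 ^ n)) :
    |y - x| ≤ (1 / 2) ^ n := by
  have h := abs_sub_le_of_le_of_le hy.1 hy.2 (mem_Icc_floor_div n x).1 (mem_Icc_floor_div n x).2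
  rwa [add_div, add_sub_cancel_left, ← one_div_pow] at h

/-- The lower dyadic approximations converge uniformly on `[0,1)²`. -/
lemma exists_forall_abs_lowerApprox_sub_le {c : ℝ × ℝ → ℝ}
    (hc : ContinuousOn c (Set.Icc 0 1 ×ˢ Set.Icc 0 1)) {ε : ℝ} (hε : 0 < ε) :
    ∃ N, ∀ n ≥ N, ∀ p ∈ Set.Ico (0:ℝ) 1 ×ˢ Set.Ico (0:ℝ) 1, |lowerApprox c n p - c p| ≤ ε := by
  have huc := (isCompact_Icc.prod isCompact_Icc).uniformContinuousOn_of_continuous hc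
  obtain ⟨δ, hδ, hcδ⟩ := Metric.uniformContinuousOn_iff.mp huc ε hε
  obtain ⟨N, hN⟩ := exists_pow_lt_of_lt_one hδ (by norm_num : (1 / 2 : ℝ) < 1)
  refine ⟨N, fun n hn p hp => ?_⟩
  have hmem : p ∈ dyadicSquare n p := ⟨mem_Icc_floor_div n p.1, mem_Icc_floor_div n p.2⟩
  have hclose : ∀ q ∈ dyadicSquare n p, |c q - c p| < ε := fun q hq => by
    refine hcδ q ?_ p (Ico_prod_subset_Icc_prod hp) ?_
    · exact ⟨Icc_floor_div_subset n hp.1 hq.1, Icc_floor_div_subset n hp.2 hq.2⟩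
    · refine lt_of_le_of_lt (max_le ?_ ?_)
        ((pow_le_pow_of_le_one (by norm_num) (by norm_num) hn).trans_lt hN)
      · exact abs_sub_le_of_mem_Icc_floor_div hq.1
      · exact abs_sub_le_of_mem_Icc_floor_div hq.2
  have hlow : c p - ε ∈ lowerBounds (c '' dyadicSquare n p) := by
    rintro _ ⟨q, hq, rfl⟩
    linarith [(abs_lt.mp (hclose q hq)).1]
  have h₁ : c p - ε ≤ lowerApprox c n p := le_csInf ⟨_, p, hmem, rfl⟩ hlow
  have h₂ : lowerApprox c n p ≤ c p := csInf_le ⟨_, hlow⟩ ⟨p, hmem, rfl⟩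
  exact abs_le.mpr ⟨by linarith, by linarith⟩

/-- **Convergence of dyadic maximizers.** Let `c : [0,1]² → ℝ` be continuous, `c̲_n` its
lower dyadic step approximations, and for each `n` let `γ̲ⁿ` be a copula measure
maximizing `∫ c̲_n dγ` over all copula measures. Then `(γ̲ⁿ)` has a weakly convergent
subsequence, and any weak limit point `γ*` of `(γ̲ⁿ)` is a copula measure maximizing
`∫ c dγ` over all copula measures. -/
theorem stmt_16 (c : ℝ × ℝ → ℝ)
    (hc : ContinuousOn c (Set.Icc 0 1 ×ˢ Set.Icc 0 1))
    (γlow : ℕ → Measure (ℝ × ℝ))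
    (hγlow : ∀ n, IsCopula (γlow n) ∧ ∀ γ : Measure (ℝ × ℝ), IsCopula γ →
      ∫ p, lowerApprox c n p ∂γ ≤ ∫ p, lowerApprox c n p ∂(γlow n)) :
    (∃ nk : ℕ → ℕ, StrictMono nk ∧ ∃ γstar : Measure (ℝ × ℝ),
      IsProbabilityMeasure γstar ∧ WeakTendsto (fun j => γlow (nk j)) γstar) ∧
    ∀ nk : ℕ → ℕ, StrictMono nk → ∀ γstar : Measure (ℝ × ℝ),
      IsProbabilityMeasure γstar → WeakTendsto (fun j => γlow (nk j)) γstar →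
      IsCopula γstar ∧
      ∀ γ : Measure (ℝ × ℝ), IsCopula γ → ∫ p, c p ∂γ ≤ ∫ p, c p ∂γstar := by
  refine ⟨exists_weakTendsto_subseq fun n => (hγlow n).1, fun nk hnk γstar hprob hlim => ?_⟩
  have hstar := isCopula_of_weakTendsto (fun j => (hγlow (nk j)).1) hlim
  refine ⟨hstar, fun γ hγ => ?_⟩
  obtain ⟨g, hg⟩ := exists_boundedContinuous_eqOn hc
  have hcg : ∀ {μ : Measure (ℝ × ℝ)}, IsCopula μ → ∫ p, c p ∂μ = ∫ p, g p ∂μ := fun hμ =>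
    integral_congr_ae <| hμ.ae_mem_Ico.mono fun p hp => (hg (Ico_prod_subset_Icc_prod hp)).symm
  rw [hcg hγ, hcg hstar]
  refine le_of_forall_pos_le_add fun ε hε => ?_
  obtain ⟨N, hN⟩ := exists_forall_abs_lowerApprox_sub_le hc (half_pos hε)
  have happrox : ∀ n ≥ N, ∀ {μ : Measure (ℝ × ℝ)}, IsCopula μ →
      |∫ p, lowerApprox c n p ∂μ - ∫ p, g p ∂μ| ≤ ε / 2 := fun n hn μ hμ => by
    have := hμ.1
    have hbound : ∀ᵐ p ∂μ, ‖lowerApprox c n p - g p‖ ≤ ε / 2 :=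
      hμ.ae_mem_Ico.mono fun p hp => by
        rw [hg (Ico_prod_subset_Icc_prod hp)]
        exact hN n hn p hp
    have hsub : Integrable (fun p => lowerApprox c n p - g p) μ :=
      .of_bound ((measurable_lowerApprox c n).sub g.continuous.measurable).aestronglyMeasurable
        _ hbound
    have hlow : Integrable (lowerApprox c n) μ := by
      simpa [Pi.add_def] using hsub.add (g.integrable μ)
    rw [← integral_sub hlow (g.integrable μ)]
    simpa using norm_integral_le_of_norm_le_const hbound
  refine ge_of_tendsto ((hlim g).add_const ε) ?_
  filter_upwards [hnk.tendsto_atTop.eventually_ge_atTop N] with j hj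
  have h₁ := abs_le.mp (happrox _ hj hγ)
  have h₂ := abs_le.mp (happrox _ hj (hγlow (nk j)).1)
  have h₃ := (hγlow (nk j)).2 γ hγ
  linarith
end
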